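/- arXiv:2304.00588 — 2 statements merged into one kernel-verified Lean document; each statement's English description precedes it below -/
import Mathlib

section
/- The extended Grundy value of the component bulb^2 ++ socket^1 ++ bulb^3 ++ socket^1 ++ bulb^1 ++ socket^3 ++ bulb^1 equals ∞ (the component is the moon). -/
/-- A piece of a Christmas lights' fixture: a (broken-but-replaceable) bulb
or a (broken) socket. -/
inductive Piece : Type
  | bulb : Piece
  | socket : Piece
  deriving DecidableEq

/-- A component is a finite list of pieces; index 0 is nearest the plug. -/
abbrev Component := List Piece

/-- A sequence of `n` bulbs. -/
def bulbs (n : ℕ) : Component := List.replicate n Piece.bulb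

/-- A sequence of `m` sockets. -/
def sockets (m : ℕ) : Component := List.replicate m Piece.socket

/-- The entries at positions `i-1` and `i+1` both exist and both equal bulb. -/
def Sandwiched (L : Component) (i : ℕ) : Prop :=
  0 < i ∧ L[i-1]? = some Piece.bulb ∧ L[i+1]? = some Piece.bulb

/-- `L'` is obtained from `L` by a quiet move: either fix a bulb (truncating
everything to its right), or remove a socket that is not sandwiched between
two bulbs. -/
def QuietOption (L L' : Component) : Prop :=
  (∃ i, L[i]? = some Piece.bulb ∧ L' = L.take i) ∨
  (∃ i, L[i]? = some Piece.socket ∧ ¬ Sandwiched L i ∧ L' = L.eraseIdx i)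

/-- `L'` is obtained from `L` by a carry-on move: remove a socket sandwiched
between two bulbs (the mover must move again). -/
def CarryOption (L L' : Component) : Prop :=
  ∃ i, L[i]? = some Piece.socket ∧ Sandwiched L i ∧ L' = L.eraseIdx i

/-- A position is a finite multiset of components. -/
abbrev Position := Multiset Component

/-- Total number of pieces in a position. -/
def Position.size (pos : Position) : ℕ := (pos.map List.length).sum

/-- Fuel-indexed winning predicate; `WinN n pos` agrees with the intended
`Win pos` whenever `n ≥ Position.size pos`, since every move strictly
decreases the total number of pieces. -/
def WinN : ℕ → Position → Prop
  | 0, _ => False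
  | n+1, pos =>
      (∃ L ∈ pos, ∃ L', QuietOption L L' ∧ ¬ WinN n (L' ::ₘ pos.erase L)) ∨
      (∃ L ∈ pos, ∃ L', CarryOption L L' ∧ WinN n (L' ::ₘ pos.erase L))

/-- The player to move wins `pos` (normal play convention): some quiet move
leads to a losing position for the opponent, or some carry-on move leads to a
position the mover (still to move) wins. -/
def Win (pos : Position) : Prop := WinN (Position.size pos) pos

open Classical in
/-- Fuel-indexed extended Grundy value; `gN n L` agrees with the intended
value whenever `n ≥ L.length`, since every option of `L` is strictly
shorter. -/
noncomputable def gN : ℕ → Component → ℕ∞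
  | 0, _ => 0
  | n+1, L =>
      let S : Set ℕ := {k | ∃ L', QuietOption L L' ∧ gN n L' = (k : ℕ∞)}
      let C : Set ℕ∞ := {v | ∃ L', CarryOption L L' ∧ gN n L' = v}
      if (⊤ : ℕ∞) ∈ C ∨ (∃ a ∈ C, ∃ b ∈ C, a ≠ b) ∨
          (∃ k : ℕ, C = {(k : ℕ∞)} ∧ k ∈ S) then ⊤
      else if h : ∃ k : ℕ, C = {(k : ℕ∞)} ∧ k ∉ S then (h.choose : ℕ∞)
      else ((sInf {k : ℕ | k ∉ S} : ℕ) : ℕ∞)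

/-- The extended Grundy value `g L ∈ ℕ ∪ {∞}` of a component. -/
noncomputable def g (L : Component) : ℕ∞ := gN L.length L

/-- A component is bulb-headed if it is empty or its first piece is a bulb. -/
def BulbHeaded (L : Component) : Prop := L = [] ∨ L.head? = some Piece.bulb

instance (L : Component) (i : ℕ) : Decidable (Sandwiched L i) := by
  unfold Sandwiched; infer_instance

/-- The quiet options of a component, as a list. -/
def quietOptions (L : Component) : List Component :=
  ((List.range L.length).filterMap fun i =>
    if L[i]? = some Piece.bulb then some (L.take i)
    else if Sandwiched L i then none else some (L.eraseIdx i)).dedup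

/-- The carry-on options of a component, as a list. -/
def carryOptions (L : Component) : List Component :=
  ((List.range L.length).filterMap fun i =>
    if L[i]? = some Piece.socket ∧ Sandwiched L i then some (L.eraseIdx i) else none).dedup

theorem mem_quietOptions {L L' : Component} : L' ∈ quietOptions L ↔ QuietOption L L' := by
  simp only [quietOptions, List.mem_dedup, List.mem_filterMap, List.mem_range, QuietOption]
  constructor
  · rintro ⟨i, hi, h⟩
    have hL : L[i]? = some L[i] := List.getElem?_eq_getElem hi
    split_ifs at h with hb hs
    · exact .inl ⟨i, hb, (Option.some.inj h).symm⟩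
    · refine .inr ⟨i, ?_, hs, (Option.some.inj h).symm⟩
      rw [hL] at hb ⊢
      cases hp : L[i] <;> simp_all
  · rintro (⟨i, hb, rfl⟩ | ⟨i, hb, hs, rfl⟩) <;>
      exact ⟨i, (List.getElem?_eq_some_iff.mp hb).1, by simp [*]⟩

theorem mem_carryOptions {L L' : Component} : L' ∈ carryOptions L ↔ CarryOption L L' := by
  simp only [carryOptions, List.mem_dedup, List.mem_filterMap, List.mem_range, CarryOption]
  constructor
  · rintro ⟨i, -, h⟩
    split_ifs at h with hs
    exact ⟨i, hs.1, hs.2, (Option.some.inj h).symm⟩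
  · rintro ⟨i, hb, hs, rfl⟩
    exact ⟨i, (List.getElem?_eq_some_iff.mp hb).1, by simp [*]⟩

/-- The least natural number `k` such that `some k` is not in the list. -/
def listMex (l : List (Option ℕ)) : ℕ :=
  ((List.range (l.length + 1)).find? fun k => some k ∉ l).getD 0

theorem listMex_eq_sInf (l : List (Option ℕ)) : listMex l = sInf {k : ℕ | some k ∉ l} := by
  unfold listMex
  cases h : (List.range (l.length + 1)).find? fun k => some k ∉ l with
  | none =>
    have hsub : (List.range (l.length + 1)).map some ⊆ l := by
      intro x hx
      obtain ⟨k, hk, rfl⟩ := List.mem_map.mp hx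
      simpa using List.find?_eq_none.mp h k hk
    have hnd : ((List.range (l.length + 1)).map (some : ℕ → Option ℕ)).Nodup :=
      List.nodup_range.map (Option.some_injective ℕ)
    have := (hnd.subperm hsub).length_le
    simp at this
  | some k =>
    rw [List.find?_range_eq_some] at h
    obtain ⟨hk, -, hlt⟩ := h
    refine (IsLeast.csInf_eq ⟨by simpa using hk, fun j hj => ?_⟩).symm
    by_contra! hjk
    exact hj (by simpa using hlt j hjk)

/-- A computable version of `gN`, with `none` standing for `∞`. -/
def grundyValue : ℕ → Component → Option ℕ
  | 0, _ => some 0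
  | n + 1, L =>
    match (carryOptions L).map (grundyValue n) with
    | [] => some (listMex ((quietOptions L).map (grundyValue n)))
    | v :: vs =>
      if (∀ w ∈ vs, w = v) ∧ v ∉ (quietOptions L).map (grundyValue n) then v else none

theorem grundyValue_succ_eq_none_or_eq {n : ℕ} {L L' : Component} (hc : L' ∈ carryOptions L) :
    grundyValue (n + 1) L = none ∨ grundyValue (n + 1) L = grundyValue n L' ∧
      grundyValue n L' ∉ (quietOptions L).map (grundyValue n) := by
  have hmem : grundyValue n L' ∈ (carryOptions L).map (grundyValue n) := List.mem_map_of_mem hc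
  rw [grundyValue]
  cases h : (carryOptions L).map (grundyValue n) with
  | nil => simp [h] at hmem
  | cons v vs =>
    rw [h, List.mem_cons] at hmem
    dsimp only
    split_ifs with hv
    · have heq : grundyValue n L' = v := hmem.elim id (hv.1 _)
      exact .inr ⟨heq.symm, heq ▸ hv.2⟩
    · exact .inl rfl

theorem grundyValue_succ_eq_none_of_carry {n : ℕ} {L : Component} (L' : Component)
    (hc : L' ∈ carryOptions L) (h : grundyValue n L' = none) : grundyValue (n + 1) L = none :=
  (grundyValue_succ_eq_none_or_eq hc).elim id fun h' => h'.1.trans h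

theorem grundyValue_succ_eq_none_of_carry_of_quiet {n : ℕ} {L : Component} (L' L'' : Component)
    (hc : L' ∈ carryOptions L) (hq : L'' ∈ quietOptions L)
    (h : grundyValue n L' = grundyValue n L'') : grundyValue (n + 1) L = none :=
  (grundyValue_succ_eq_none_or_eq hc).elim id fun h' =>
    absurd (h ▸ List.mem_map_of_mem hq) h'.2

/-- The extended natural number denoted by an optional one, `none` being `∞`. -/
def optionToENat (o : Option ℕ) : ℕ∞ := o.elim ⊤ (↑)

theorem optionToENat_injective : Function.Injective optionToENat := by
  rintro (_ | a) (_ | b) h <;> simp_all [optionToENat]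

open Classical in
/-- The extended Grundy value determined by the finite values `S` of the quiet options and the
values `C` of the carry-on options. -/
noncomputable def extendedMex (S : Set ℕ) (C : Set ℕ∞) : ℕ∞ :=
  if (⊤ : ℕ∞) ∈ C ∨ (∃ a ∈ C, ∃ b ∈ C, a ≠ b) ∨ (∃ k : ℕ, C = {(k : ℕ∞)} ∧ k ∈ S) then ⊤
  else if h : ∃ k : ℕ, C = {(k : ℕ∞)} ∧ k ∉ S then (h.choose : ℕ∞)
  else ((sInf {k : ℕ | k ∉ S} : ℕ) : ℕ∞)

theorem gN_succ (n : ℕ) (L : Component) :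
    gN (n + 1) L = extendedMex {k | ∃ L', QuietOption L L' ∧ gN n L' = (k : ℕ∞)}
      {v | ∃ L', CarryOption L L' ∧ gN n L' = v} := by
  rw [gN, extendedMex]

theorem gN_eq_grundyValue (n : ℕ) (L : Component) : gN n L = optionToENat (grundyValue n L) := by
  induction n generalizing L with
  | zero => simp [gN, grundyValue, optionToENat]
  | succ n ih =>
    have hS : {k : ℕ | ∃ L', QuietOption L L' ∧ gN n L' = (k : ℕ∞)} =
        {k | some k ∈ (quietOptions L).map (grundyValue n)} := by
      ext k
      simp only [Set.mem_ofPred_eq, List.mem_map, mem_quietOptions, ih]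
      exact exists_congr fun _ => and_congr_right fun _ =>
        optionToENat_injective.eq_iff (b := some k)
    have hC : {v : ℕ∞ | ∃ L', CarryOption L L' ∧ gN n L' = v} =
        optionToENat '' {o | o ∈ (carryOptions L).map (grundyValue n)} := by
      ext v
      simp [mem_carryOptions, ih]
    rw [gN_succ, grundyValue, hS, hC, extendedMex]
    generalize (quietOptions L).map (grundyValue n) = S
    cases (carryOptions L).map (grundyValue n) with
    | nil =>
      have hne (k : ℕ) : ¬ (∅ : Set ℕ∞) = {(k : ℕ∞)} := (Set.singleton_ne_empty _).symm
      simp [listMex_eq_sInf, optionToENat, hne]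
    | cons v vs =>
      dsimp only
      by_cases hvs : ∀ w ∈ vs, w = v
      · have hset : {o | o ∈ v :: vs} = {v} := by
          ext o
          simpa using hvs o
        rw [hset, Set.image_singleton]
        cases v with
        | none => simp [optionToENat]
        | some m =>
          by_cases hm : some m ∈ S
          · rw [if_pos (.inr (.inr ⟨m, rfl, hm⟩)), if_neg (by simp [hm])]
            rfl
          · have hex : ∃ k : ℕ, ({optionToENat (some m)} : Set ℕ∞) = {(k : ℕ∞)} ∧
                k ∉ {k | some k ∈ S} := ⟨m, rfl, hm⟩
            rw [if_neg, dif_pos hex, if_pos ⟨hvs, hm⟩]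
            · exact (Set.singleton_injective hex.choose_spec.1).symm
            · rintro (h | ⟨a, rfl, b, rfl, h⟩ | ⟨k, hk, hkS⟩)
              · simp [optionToENat] at h
              · exact h rfl
              · have hmk : m = k := by simpa [optionToENat] using hk
                exact hm (hmk ▸ hkS)
      · rw [if_pos, if_neg fun h : _ ∧ _ => hvs h.1]
        · rfl
        · push Not at hvs
          obtain ⟨w, hw, hwv⟩ := hvs
          exact .inr (.inl ⟨_, ⟨w, by simp [hw], rfl⟩, _, ⟨v, by simp, rfl⟩,
            optionToENat_injective.ne hwv⟩)

theorem g_eq_top_of_grundyValue {L : Component} (h : grundyValue L.length L = none) :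
    g L = ⊤ := by
  rw [g, gN_eq_grundyValue, h]
  rfl

/-- The extended Grundy value of
`bulb^2 ++ socket^1 ++ bulb^3 ++ socket^1 ++ bulb^1 ++ socket^3 ++ bulb^1`
equals `∞` (the component is the moon). -/
theorem stmt13 :
    g (bulbs 2 ++ sockets 1 ++ bulbs 3 ++ sockets 1 ++ bulbs 1 ++ sockets 3 ++
        bulbs 1) = (⊤ : ℕ∞) :=
  g_eq_top_of_grundyValue <|
    grundyValue_succ_eq_none_of_carry
      (bulbs 5 ++ sockets 1 ++ bulbs 1 ++ sockets 3 ++ bulbs 1) (by decide +kernel) <|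
    grundyValue_succ_eq_none_of_carry_of_quiet
      (bulbs 6 ++ sockets 3 ++ bulbs 1) (bulbs 5 ++ sockets 1)
      (by decide +kernel) (by decide +kernel) (by decide +kernel)
end

section
/- (Soundness of the extended Grundy value for CHRISTMAS LIGHTS' FIXTURE) Let pos be a position consisting of components L₁, …, Lₙ. Then pos is a previous-player win (¬Win(pos)) if and only if every g(Lᵢ) is finite and the bitwise XOR (nim-sum) g(L₁) ⊕ … ⊕ g(Lₙ) equals 0. In particular, if some component has g(Lᵢ) = ∞ then Win(pos) holds. -/
theorem QuietOption.length_lt {L L' : Component} (h : QuietOption L L') :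
    L'.length < L.length := by
  rcases h with ⟨i, hi, rfl⟩ | ⟨i, hi, -, rfl⟩
  · obtain ⟨h, -⟩ := List.getElem?_eq_some_iff.1 hi
    simpa using h
  · obtain ⟨h, -⟩ := List.getElem?_eq_some_iff.1 hi
    rw [List.length_eraseIdx_of_lt h]
    omega

theorem CarryOption.length_lt {L L' : Component} (h : CarryOption L L') :
    L'.length < L.length := by
  obtain ⟨i, hi, -, rfl⟩ := h
  obtain ⟨h, -⟩ := List.getElem?_eq_some_iff.1 hi
  rw [List.length_eraseIdx_of_lt h]
  omega

theorem finite_setOf_quietOption (L : Component) : {L' | QuietOption L L'}.Finite := by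
  refine (((Set.finite_Iio L.length).image fun i => L.take i).union
    ((Set.finite_Iio L.length).image fun i => L.eraseIdx i)).subset ?_
  rintro L' (⟨i, hi, rfl⟩ | ⟨i, hi, -, rfl⟩)
  · exact Or.inl ⟨i, (List.getElem?_eq_some_iff.1 hi).1, rfl⟩
  · exact Or.inr ⟨i, (List.getElem?_eq_some_iff.1 hi).1, rfl⟩

open Classical in
/-- The extended Grundy value determined by the finite values `S` of the quiet options and the
values `C` of the carry-on options. -/
noncomputable def extMex (S : Set ℕ) (C : Set ℕ∞) : ℕ∞ :=
  if (⊤ : ℕ∞) ∈ C ∨ (∃ a ∈ C, ∃ b ∈ C, a ≠ b) ∨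
      (∃ k : ℕ, C = {(k : ℕ∞)} ∧ k ∈ S) then ⊤
  else if h : ∃ k : ℕ, C = {(k : ℕ∞)} ∧ k ∉ S then (h.choose : ℕ∞)
  else ((sInf {k : ℕ | k ∉ S} : ℕ) : ℕ∞)

theorem extMex_empty (S : Set ℕ) : extMex S ∅ = ((sInf {k : ℕ | k ∉ S} : ℕ) : ℕ∞) := by
  have h (k : ℕ) : (∅ : Set ℕ∞) ≠ {(k : ℕ∞)} := (Set.singleton_ne_empty _).symm
  simp [extMex, h]

theorem extMex_eq_top_iff {S : Set ℕ} {C : Set ℕ∞} :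
    extMex S C = ⊤ ↔ (⊤ : ℕ∞) ∈ C ∨ (∃ a ∈ C, ∃ b ∈ C, a ≠ b) ∨
      (∃ k : ℕ, C = {(k : ℕ∞)} ∧ k ∈ S) := by
  unfold extMex
  split_ifs with h₁ h₂
  · simp [h₁]
  · simp [h₁]
  · simp [h₁]

/-- A finite extended Grundy value is either the mex of the quiet values, when there is no
carry-on option, or the common value of the carry-on options. -/
theorem extMex_of_ne_top {S : Set ℕ} {C : Set ℕ∞} (h : extMex S C ≠ ⊤) :
    C = ∅ ∨ ∃ k : ℕ, C = {(k : ℕ∞)} ∧ k ∉ S ∧ extMex S C = k := by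
  rcases C.eq_empty_or_nonempty with hC | ⟨a, ha⟩
  · exact Or.inl hC
  right
  have h₁ := mt extMex_eq_top_iff.2 h
  have h₂ := h₁
  push Not at h₁
  obtain ⟨hn, hab, hk⟩ := h₁
  have hat : a ≠ ⊤ := fun e => hn (e ▸ ha)
  lift a to ℕ using hat
  have hC : C = {(a : ℕ∞)} := Set.eq_singleton_iff_unique_mem.2 ⟨ha, fun b hb => hab b hb a ha⟩
  have hex : ∃ k : ℕ, C = {(k : ℕ∞)} ∧ k ∉ S := ⟨a, hC, hk a hC⟩
  refine ⟨hex.choose, hex.choose_spec.1, hex.choose_spec.2, ?_⟩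
  rw [extMex, if_neg h₂, dif_pos hex]

theorem gN_eq_gN {n m : ℕ} {L : Component} (hn : L.length ≤ n) (hm : L.length ≤ m) :
    gN n L = gN m L := by
  induction n generalizing m L with
  | zero =>
    obtain rfl : L = [] := List.length_eq_zero_iff.1 (by omega)
    cases m with
    | zero => rfl
    | succ m =>
      change _ = extMex _ _
      simp [gN, QuietOption, CarryOption, extMex_empty]
  | succ n ih =>
    cases m with
    | zero =>
      obtain rfl : L = [] := List.length_eq_zero_iff.1 (by omega)
      change extMex _ _ = _
      simp [gN, QuietOption, CarryOption, extMex_empty]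
    | succ m =>
      change extMex _ _ = extMex _ _
      congr 1
      · ext k
        refine exists_congr fun L' => and_congr_right fun h => ?_
        have := h.length_lt
        rw [ih (m := m) (by omega) (by omega)]
      · ext k
        refine exists_congr fun L' => and_congr_right fun h => ?_
        have := h.length_lt
        rw [ih (m := m) (by omega) (by omega)]

theorem g_eq_extMex (L : Component) :
    g L = extMex {k | ∃ L', QuietOption L L' ∧ g L' = (k : ℕ∞)}
      {v | ∃ L', CarryOption L L' ∧ g L' = v} := by
  rw [g, gN_eq_gN (m := L.length + 1) le_rfl (by omega)]
  change extMex _ _ = extMex _ _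
  congr 1
  · ext k
    refine exists_congr fun L' => and_congr_right fun h => ?_
    rw [g, gN_eq_gN h.length_lt.le le_rfl]
  · ext k
    refine exists_congr fun L' => and_congr_right fun h => ?_
    rw [g, gN_eq_gN h.length_lt.le le_rfl]

theorem CarryOption.g_eq {L L' : Component} (h : CarryOption L L') (hL : g L ≠ ⊤) :
    g L' = g L := by
  have hmem : g L' ∈ {v | ∃ L', CarryOption L L' ∧ g L' = v} := ⟨L', h, rfl⟩
  rw [g_eq_extMex L] at hL ⊢
  rcases extMex_of_ne_top hL with hC | ⟨k, hC, -, hk⟩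
  · simp [hC] at hmem
  · rw [hk]
    rwa [hC] at hmem

theorem g_of_forall_not_carryOption {L : Component} (h : ∀ L', ¬ CarryOption L L') :
    g L = ((sInf {k : ℕ | ¬ ∃ L', QuietOption L L' ∧ g L' = (k : ℕ∞)} : ℕ) : ℕ∞) := by
  rw [g_eq_extMex L]
  have hC : {v | ∃ L', CarryOption L L' ∧ g L' = v} = ∅ := by
    ext v
    simp [h]
  rw [hC, extMex_empty]
  rfl

theorem exists_not_quietOption_value (L : Component) :
    {k : ℕ | ¬ ∃ L', QuietOption L L' ∧ g L' = (k : ℕ∞)}.Nonempty := by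
  have hfin : {k : ℕ | ∃ L', QuietOption L L' ∧ g L' = (k : ℕ∞)}.Finite :=
    ((finite_setOf_quietOption L).image g).preimage
      (f := fun k : ℕ => (k : ℕ∞)) (fun a _ b _ hab => by simpa using hab)
  exact hfin.infinite_compl.nonempty

theorem QuietOption.g_ne {L L' : Component} (h : QuietOption L L') (hL : g L ≠ ⊤) :
    g L' ≠ g L := by
  intro heq
  by_cases hC : ∃ L', CarryOption L L'
  · obtain ⟨L'', hL''⟩ := hC
    rw [g_eq_extMex L] at hL heq
    rcases extMex_of_ne_top hL with hC | ⟨k, -, hS, hk⟩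
    · have hmem : g L'' ∈ {v | ∃ L', CarryOption L L' ∧ g L' = v} := ⟨L'', hL'', rfl⟩
      simp [hC] at hmem
    · exact hS ⟨L', h, heq.trans hk⟩
  · push Not at hC
    exact Nat.sInf_mem (exists_not_quietOption_value L)
      ⟨L', h, heq.trans (g_of_forall_not_carryOption hC)⟩

theorem exists_quietOption_of_lt {L : Component} (h : ∀ L', ¬ CarryOption L L') {k : ℕ}
    (hk : k < (g L).toNat) : ∃ L', QuietOption L L' ∧ g L' = (k : ℕ∞) := by
  rw [g_of_forall_not_carryOption h, ENat.toNat_natCast] at hk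
  exact not_not.1 (Nat.notMem_of_lt_sInf hk)

theorem exists_carryOption_of_g_eq_top {L : Component} (h : g L = ⊤) :
    ∃ L', CarryOption L L' := by
  by_contra! hC
  rw [g_of_forall_not_carryOption hC] at h
  exact ENat.natCast_ne_top _ h

theorem exists_option_of_g_eq_top {L : Component} (h : g L = ⊤) (x : ℕ) :
    (∃ L', CarryOption L L' ∧ g L' ≠ x) ∨ ∃ L', QuietOption L L' ∧ g L' = (x : ℕ∞) := by
  rw [g_eq_extMex, extMex_eq_top_iff] at h
  rcases h with ⟨L', hL', h⟩ | ⟨_, ⟨A, hA, rfl⟩, _, ⟨B, hB, rfl⟩, hab⟩ | ⟨k, hC, L', hL', hk⟩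
  · exact Or.inl ⟨L', hL', by simp [h]⟩
  · by_cases hx : g A = x
    · exact Or.inl ⟨B, hB, fun hx' => hab (hx.trans hx'.symm)⟩
    · exact Or.inl ⟨A, hA, hx⟩
  · by_cases hx : k = x
    · exact Or.inr ⟨L', hL', hx ▸ hk⟩
    · obtain ⟨B, hB, hBk⟩ : (k : ℕ∞) ∈ {v | ∃ L', CarryOption L L' ∧ g L' = v} := by simp [hC]
      exact Or.inl ⟨B, hB, by rw [hBk]; exact_mod_cast hx⟩

instance leftCommutative_xor_g :
    LeftCommutative fun (L : Component) (acc : ℕ) => (g L).toNat ^^^ acc :=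
  ⟨fun _ _ _ => Nat.xor_left_comm _ _ _⟩

/-- The nim-sum of the Grundy values of the components, where infinite values count as `0`. -/
noncomputable def nimSum (s : Position) : ℕ :=
  s.foldr (fun L acc => (g L).toNat ^^^ acc) 0

@[simp]
theorem nimSum_zero : nimSum 0 = 0 := rfl

@[simp]
theorem nimSum_cons (L : Component) (s : Position) :
    nimSum (L ::ₘ s) = (g L).toNat ^^^ nimSum s :=
  Multiset.foldr_cons _ _ _ _

@[simp]
theorem Position.size_cons (L : Component) (s : Position) :
    Position.size (L ::ₘ s) = L.length + Position.size s := by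
  simp [Position.size]

theorem testBit_nimSum {s : Position} {i : ℕ} (h : (nimSum s).testBit i = true) :
    ∃ L ∈ s, (g L).toNat.testBit i = true := by
  induction s using Multiset.induction with
  | empty => simp at h
  | cons L s ih =>
    by_cases hL : (g L).toNat.testBit i = true
    · exact ⟨L, by simp, hL⟩
    · have hs : (nimSum s).testBit i = true := by simpa [Nat.testBit_xor, hL] using h
      obtain ⟨M, hM, hMi⟩ := ih hs
      exact ⟨M, by simp [hM], hMi⟩

/-- In a nonzero nim-sum some summand can be decreased so as to cancel the sum. -/
theorem exists_xor_nimSum_lt {s : Position} (h : nimSum s ≠ 0) :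
    ∃ L ∈ s, (g L).toNat ^^^ nimSum s < (g L).toNat := by
  obtain ⟨i, hi, hmax⟩ := Nat.exists_most_significant_bit h
  obtain ⟨L, hL, hLi⟩ := testBit_nimSum hi
  refine ⟨L, hL, Nat.lt_of_testBit i ?_ hLi fun j hj => ?_⟩
  · simp [Nat.testBit_xor, hi, hLi]
  · simp [Nat.testBit_xor, hmax j hj]

theorem winN_succ_iff {n : ℕ} {s : Position} :
    WinN (n + 1) s ↔ ∃ L t, s = L ::ₘ t ∧
      ((∃ L', QuietOption L L' ∧ ¬ WinN n (L' ::ₘ t)) ∨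
        ∃ L', CarryOption L L' ∧ WinN n (L' ::ₘ t)) := by
  constructor
  · rintro (⟨L, hL, h⟩ | ⟨L, hL, h⟩)
    · exact ⟨L, s.erase L, (Multiset.cons_erase hL).symm, Or.inl h⟩
    · exact ⟨L, s.erase L, (Multiset.cons_erase hL).symm, Or.inr h⟩
  · rintro ⟨L, t, rfl, h | h⟩
    · exact Or.inl ⟨L, Multiset.mem_cons_self _ _, by rwa [Multiset.erase_cons_head]⟩
    · exact Or.inr ⟨L, Multiset.mem_cons_self _ _, by rwa [Multiset.erase_cons_head]⟩

theorem g_nil : g [] = 0 := rfl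

theorem g_eq_zero_of_size_eq_zero {s : Position} (h : s.size = 0) {L : Component} (hL : L ∈ s) :
    g L = 0 := by
  obtain ⟨t, rfl⟩ := Multiset.exists_cons_of_mem hL
  rw [Position.size_cons] at h
  rw [List.length_eq_zero_iff.1 (by omega : L.length = 0), g_nil]

theorem winN_iff {n : ℕ} {s : Position} (hn : s.size ≤ n) :
    WinN n s ↔ (∃ L ∈ s, g L = ⊤) ∨ nimSum s ≠ 0 := by
  induction n generalizing s with
  | zero =>
    have hg (L : Component) (hL : L ∈ s) : g L = 0 := g_eq_zero_of_size_eq_zero (by omega) hL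
    have h₀ : nimSum s = 0 := by
      by_contra h
      obtain ⟨L, hL, hlt⟩ := exists_xor_nimSum_lt h
      simp [hg L hL] at hlt
    simp only [WinN, h₀, false_iff]
    rintro (⟨L, hL, h⟩ | h)
    · simp [hg L hL] at h
    · exact h rfl
  | succ n ih =>
    have ihq {L L' : Component} {t : Position} (hs : s = L ::ₘ t) (h : L'.length < L.length) :
        WinN n (L' ::ₘ t) ↔
          (g L' = ⊤ ∨ ∃ M ∈ t, g M = ⊤) ∨ (g L').toNat ^^^ nimSum t ≠ 0 := by
      have hsize : Position.size (L' ::ₘ t) ≤ n := by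
        rw [hs, Position.size_cons] at hn
        rw [Position.size_cons]
        omega
      simp only [ih hsize, nimSum_cons, Multiset.mem_cons, exists_eq_or_imp, ne_eq]
    rw [winN_succ_iff]
    constructor
    · rintro ⟨L, t, hs, hmove⟩
      by_contra! hlose
      obtain ⟨hfin, hsum⟩ := hlose
      have hL : g L ≠ ⊤ := hfin L (by simp [hs])
      have ht (M : Component) (hM : M ∈ t) : g M ≠ ⊤ := hfin M (by simp [hs, hM])
      rw [hs, nimSum_cons] at hsum
      rcases hmove with ⟨L', hq, hw⟩ | ⟨L', hc, hw⟩
      · rw [ihq hs hq.length_lt] at hw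
        push Not at hw
        obtain ⟨⟨hL', -⟩, hsum'⟩ := hw
        refine hq.g_ne hL ?_
        rw [← ENat.natCast_toNat hL', ← ENat.natCast_toNat hL, Nat.xor_eq_zero_iff.1 hsum,
          Nat.xor_eq_zero_iff.1 hsum']
      · rw [ihq hs hc.length_lt, hc.g_eq hL] at hw
        rcases hw with (h | ⟨M, hM, h⟩) | h
        · exact hL h
        · exact ht M hM h
        · exact h hsum
    · intro hwin
      by_cases htop : ∃ L ∈ s, g L = ⊤
      · obtain ⟨L, hL, hgL⟩ := htop
        obtain ⟨t, hs⟩ := Multiset.exists_cons_of_mem hL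
        refine ⟨L, t, hs, ?_⟩
        by_cases ht : ∃ M ∈ t, g M = ⊤
        · obtain ⟨L', hc⟩ := exists_carryOption_of_g_eq_top hgL
          exact Or.inr ⟨L', hc, (ihq hs hc.length_lt).2 (Or.inl (Or.inr ht))⟩
        · rcases exists_option_of_g_eq_top hgL (nimSum t) with ⟨L', hc, hne⟩ | ⟨L', hq, heq⟩
          · refine Or.inr ⟨L', hc, (ihq hs hc.length_lt).2 ?_⟩
            by_cases hL' : g L' = ⊤
            · exact Or.inl (Or.inl hL')
            · refine Or.inr fun hx => hne ?_
              rw [← ENat.natCast_toNat hL', Nat.xor_eq_zero_iff.1 hx]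
          · refine Or.inl ⟨L', hq, ?_⟩
            rw [ihq hs hq.length_lt]
            simp [heq, ht]
      · have hsum := hwin.resolve_left htop
        push Not at htop
        by_cases hcarry : ∃ L ∈ s, ∃ L', CarryOption L L'
        · obtain ⟨L, hL, L', hc⟩ := hcarry
          obtain ⟨t, hs⟩ := Multiset.exists_cons_of_mem hL
          refine ⟨L, t, hs, Or.inr ⟨L', hc, (ihq hs hc.length_lt).2 (Or.inr ?_)⟩⟩
          rwa [hc.g_eq (htop L hL), ← nimSum_cons, ← hs]
        · push Not at hcarry
          obtain ⟨L, hL, hlt⟩ := exists_xor_nimSum_lt hsum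
          obtain ⟨t, hs⟩ := Multiset.exists_cons_of_mem hL
          obtain ⟨L', hq, heq⟩ := exists_quietOption_of_lt (hcarry L hL) hlt
          refine ⟨L, t, hs, Or.inl ⟨L', hq, ?_⟩⟩
          have ht : ¬ ∃ M ∈ t, g M = ⊤ := fun ⟨M, hM, h⟩ => htop M (by simp [hs, hM]) h
          rw [hs, nimSum_cons, ← Nat.xor_assoc, Nat.xor_self, Nat.zero_xor] at heq
          rw [ihq hs hq.length_lt]
          simp [heq, ht]

/-- Soundness of the extended Grundy value: a position with
components `L₁, …, Lₙ` is a previous-player win if and only if every `g Lᵢ` is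
finite and the nim-sum (bitwise XOR) of the values is `0`. In particular, if
some component has value `∞`, the player to move wins. -/
theorem stmt15 (pos : List Component) :
    (¬ Win (↑pos : Multiset Component) ↔
      (∀ L ∈ pos, g L ≠ ⊤) ∧
        pos.foldr (fun L acc => Nat.xor (g L).toNat acc) 0 = 0) ∧
    ((∃ L ∈ pos, g L = ⊤) → Win (↑pos : Multiset Component)) := by
  have hwin : Win (↑pos : Multiset Component) ↔
      (∃ L ∈ pos, g L = ⊤) ∨ pos.foldr (fun L acc => Nat.xor (g L).toNat acc) 0 ≠ 0 :=
    winN_iff le_rfl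
  refine ⟨?_, fun h => hwin.2 (Or.inl h)⟩
  rw [hwin]
  push Not
  rfl
end
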